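/- Let 0 ≤ t ≤ 1/8 and set ε = (1/8 - t)^{1/3} (so 0 ≤ ε ≤ 1/2). Then every graphon g with edge density e(g) = 1/2 and triangle density t(g) = t satisfies I(g) ≥ I₀(1/2 + ε). -/

import Mathlib

open MeasureTheory Set

/-- `I₀(u) = (1/2)[u ln u + (1-u) ln(1-u)]`; since `Real.log 0 = 0`,
this automatically satisfies the continuous extension `I₀(0) = I₀(1) = 0`. -/
noncomputable def I0 (u : ℝ) : ℝ :=
  (1/2) * (u * Real.log u + (1 - u) * Real.log (1 - u))

/-- A graphon: a measurable function `[0,1]² → [0,1]`, symmetric on `[0,1]²`. -/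
def IsGraphon (g : ℝ → ℝ → ℝ) : Prop :=
  Measurable (Function.uncurry g) ∧
  (∀ x ∈ Icc (0:ℝ) 1, ∀ y ∈ Icc (0:ℝ) 1, g x y = g y x) ∧
  (∀ x ∈ Icc (0:ℝ) 1, ∀ y ∈ Icc (0:ℝ) 1, g x y ∈ Icc (0:ℝ) 1)

/-- Edge density `e(g) = ∫∫ g`. -/
noncomputable def edgeDensity (g : ℝ → ℝ → ℝ) : ℝ :=
  ∫ x in Icc (0:ℝ) 1, ∫ y in Icc (0:ℝ) 1, g x y

/-- Triangle density `t(g) = ∫∫∫ g(x,y) g(y,z) g(z,x)`. -/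
noncomputable def triangleDensity (g : ℝ → ℝ → ℝ) : ℝ :=
  ∫ x in Icc (0:ℝ) 1, ∫ y in Icc (0:ℝ) 1, ∫ z in Icc (0:ℝ) 1,
    g x y * g y z * g z x

/-- Rate function `I(g) = ∫∫ I₀(g(x,y))`. -/
noncomputable def rateFn (g : ℝ → ℝ → ℝ) : ℝ :=
  ∫ x in Icc (0:ℝ) 1, ∫ y in Icc (0:ℝ) 1, I0 (g x y)

lemma bdd_int {α : Type*} [MeasurableSpace α] {μ : Measure α} [IsFiniteMeasure μ] {F : α → ℝ}
    (hF : Measurable F) (C : ℝ) (hC : ∀ x, |F x| ≤ C) : Integrable F μ :=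
  Integrable.of_bound hF.aestronglyMeasurable C (Filter.Eventually.of_forall hC)

lemma cs_int {α : Type*} [MeasurableSpace α] {μ : Measure α} [IsProbabilityMeasure μ] {F G : α → ℝ}
    (hF : Measurable F) (hG : Measurable G) (C : ℝ) (hFC : ∀ x, |F x| ≤ C) (hGC : ∀ x, |G x| ≤ C) :
    (∫ x, F x * G x ∂μ) ^ 2 ≤ (∫ x, F x ^ 2 ∂μ) * ∫ x, G x ^ 2 ∂μ := by
  have i1 : Integrable (fun x => F x ^ 2) μ := bdd_int (by fun_prop) (C ^ 2) fun x => by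
    rw [abs_pow]; exact pow_le_pow_left₀ (abs_nonneg _) (hFC x) 2
  have i2 : Integrable (fun x => G x ^ 2) μ := bdd_int (by fun_prop) (C ^ 2) fun x => by
    rw [abs_pow]; exact pow_le_pow_left₀ (abs_nonneg _) (hGC x) 2
  have i3 : Integrable (fun x => F x * G x) μ := bdd_int (by fun_prop) (C * C) fun x => by
    rw [abs_mul]
    exact mul_le_mul (hFC x) (hGC x) (abs_nonneg _) ((abs_nonneg _).trans (hFC x))
  have key : ∀ r : ℝ, 0 ≤ (∫ x, F x ^ 2 ∂μ) * (r * r) + (2 * ∫ x, F x * G x ∂μ) * r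
      + ∫ x, G x ^ 2 ∂μ := by
    intro r
    have h : ∫ x, (r * F x + G x) ^ 2 ∂μ = (∫ x, F x ^ 2 ∂μ) * (r * r)
        + (2 * ∫ x, F x * G x ∂μ) * r + ∫ x, G x ^ 2 ∂μ := by
      have e : (fun x => (r * F x + G x) ^ 2)
          = fun x => ((r * r) * F x ^ 2 + (2 * r) * (F x * G x)) + G x ^ 2 := by
        funext x; ring
      rw [e, integral_add ((i1.const_mul _).fun_add (i3.const_mul _)) i2,
        integral_add (i1.const_mul _) (i3.const_mul _), integral_const_mul, integral_const_mul]
      ring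
    rw [← h]; exact integral_nonneg fun x => sq_nonneg _
  have := discrim_le_zero key
  unfold discrim at this
  nlinarith

lemma tri_bound {α : Type*} [MeasurableSpace α] (μ : Measure α) [IsProbabilityMeasure μ]
    (f : α → α → ℝ) (hf : Measurable (Function.uncurry f)) (hb : ∀ x y, |f x y| ≤ 1/2)
    (hs : ∀ x y, f x y = f y x) (h0 : ∫ x, ∫ y, f x y ∂μ ∂μ = 0) :
    (∫ x, ∫ y, ∫ z, (1/2 + f x y) * (1/2 + f y z) * (1/2 + f z x) ∂μ ∂μ ∂μ ≤ 1/8) →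
    (1/8 - ∫ x, ∫ y, ∫ z, (1/2 + f x y) * (1/2 + f y z) * (1/2 + f z x) ∂μ ∂μ ∂μ) ^ 2
      ≤ (∫ x, ∫ y, f x y ^ 2 ∂μ ∂μ) ^ 3 := by
  intro ht8
  have hm1 : ∀ x, Measurable fun y => f x y := fun x => hf.comp (by fun_prop : Measurable fun y => (x, y))
  have hm2 : ∀ y, Measurable fun x => f x y := fun y => hf.comp (by fun_prop : Measurable fun x => (x, y))
  have mulb : ∀ {a b A B : ℝ}, |a| ≤ A → |b| ≤ B → |a * b| ≤ A * B := fun ha hb => by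
    rw [abs_mul]; exact mul_le_mul ha hb (abs_nonneg _) ((abs_nonneg _).trans ha)
  have intb : ∀ {F : α → ℝ} {C : ℝ}, (∀ x, |F x| ≤ C) → |∫ x, F x ∂μ| ≤ C := fun {F C} h => by
    have := norm_integral_le_of_norm_le_const (μ := μ) (f := F) (C := C) (Filter.Eventually.of_forall h)
    simpa using this
  obtain ⟨D, hD⟩ : ∃ D : α → ℝ, D = fun x => ∫ y, f x y ∂μ := ⟨_, rfl⟩
  obtain ⟨T, hT⟩ : ∃ T : α → α → ℝ, T = fun x y => ∫ z, f y z * f z x ∂μ := ⟨_, rfl⟩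
  obtain ⟨A, hA⟩ : ∃ A : α → ℝ, A = fun x => ∫ y, f x y ^ 2 ∂μ := ⟨_, rfl⟩
  have Dm : Measurable D := by
    rw [hD]; exact (hf.stronglyMeasurable.integral_prod_right').measurable
  have Am : Measurable A := by
    rw [hA]
    have : Measurable fun p : α × α => f p.1 p.2 ^ 2 := (hf.pow_const 2)
    exact (this.stronglyMeasurable.integral_prod_right').measurable
  have Tm : Measurable (Function.uncurry T) := by
    rw [hT]
    have : Measurable fun p : (α × α) × α => f p.1.2 p.2 * f p.2 p.1.1 :=
      (hf.comp (by fun_prop : Measurable fun p : (α × α) × α => (p.1.2, p.2))).mul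
        (hf.comp (by fun_prop : Measurable fun p : (α × α) × α => (p.2, p.1.1)))
    exact (this.stronglyMeasurable.integral_prod_right').measurable
  have Tm1 : ∀ x, Measurable fun y => T x y := fun x => Tm.comp (by fun_prop : Measurable fun y => (x, y))
  have Db : ∀ x, |D x| ≤ 1/2 := fun x => by rw [hD]; exact intb (hb x)
  have Tb : ∀ x y, |T x y| ≤ 1/2*(1/2) := fun x y => by
    rw [hT]; exact intb fun z => mulb (hb _ _) (hb _ _)
  have sqb : ∀ x y, |f x y ^ 2| ≤ 1/2*(1/2) := fun x y => by rw [sq]; exact mulb (hb _ _) (hb _ _)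
  have Ab : ∀ x, |A x| ≤ 1/2*(1/2) := fun x => by
    rw [hA]; exact intb fun z => sqb _ _
  have fi : ∀ x, Integrable (fun y => f x y) μ := fun x => bdd_int (hm1 x) _ (hb x)
  have Di : Integrable D μ := bdd_int Dm _ Db
  have Ti : ∀ x, Integrable (fun y => T x y) μ := fun x => bdd_int (Tm1 x) _ (Tb x)
  have fDi : ∀ x, Integrable (fun y => f x y * D y) μ := fun x =>
    bdd_int ((hm1 x).mul Dm) _ fun y => mulb (hb _ _) (Db _)
  have fTi : ∀ x, Integrable (fun y => f x y * T x y) μ := fun x =>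
    bdd_int ((hm1 x).mul (Tm1 x)) _ fun y => mulb (hb _ _) (Tb _ _)
  have ID : ∫ x, D x ∂μ = 0 := by rw [hD]; exact h0
  -- inner integral
  have s1 : ∀ x y, ∫ z, (1/2 + f x y) * (1/2 + f y z) * (1/2 + f z x) ∂μ
      = (1/2 + f x y) * (1/4 + 1/2 * D y + 1/2 * D x + T x y) := by
    intro x y
    have e : (fun z => (1/2 + f x y) * (1/2 + f y z) * (1/2 + f z x)) = fun z =>
      (1/2 + f x y) * (((1/4 + 1/2 * f y z) + 1/2 * f x z) + f y z * f z x) := by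
      funext z; rw [hs z x]; ring
    have i4 : Integrable (fun z => f y z * f z x) μ :=
      bdd_int ((hm1 y).mul (hm2 x)) _ fun z => mulb (hb _ _) (hb _ _)
    rw [e, integral_const_mul, integral_add (((integrable_const _).fun_add ((fi y).const_mul _)).fun_add
      ((fi x).const_mul _)) i4, integral_add ((integrable_const _).fun_add ((fi y).const_mul _))
      ((fi x).const_mul _), integral_add (integrable_const _) ((fi y).const_mul _),
      integral_const_mul, integral_const_mul, hD, hT]
    simp
  have s2 : ∀ x, ∫ y, (1/2 + f x y) * (1/4 + 1/2 * D y + 1/2 * D x + T x y) ∂μ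
      = 1/8 + 1/2 * D x + 1/2 * (D x) ^ 2 + 1/2 * ∫ y, T x y ∂μ + 1/2 * ∫ y, f x y * D y ∂μ
        + ∫ y, f x y * T x y ∂μ := by
    intro x
    have e : (fun y => (1/2 + f x y) * (1/4 + 1/2 * D y + 1/2 * D x + T x y)) = fun y =>
      (((((1/8 + 1/4 * D x) + 1/4 * D y) + (1/4 + 1/2 * D x) * f x y) + 1/2 * T x y)
        + 1/2 * (f x y * D y)) + f x y * T x y := by
      funext z; ring
    have j1 : Integrable (fun y => (1/8 + 1/4 * D x) + 1/4 * D y) μ :=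
      (integrable_const _).fun_add (Di.const_mul _)
    have j2 : Integrable (fun y => ((1/8 + 1/4 * D x) + 1/4 * D y) + (1/4 + 1/2 * D x) * f x y) μ :=
      j1.fun_add ((fi x).const_mul _)
    have j3 := j2.fun_add ((Ti x).const_mul (1/2))
    have j4 := j3.fun_add ((fDi x).const_mul (1/2))
    rw [e, integral_add j4 (fTi x), integral_add j3 ((fDi x).const_mul _),
      integral_add j2 ((Ti x).const_mul _), integral_add j1 ((fi x).const_mul _),
      integral_add (integrable_const _) (Di.const_mul _), integral_const_mul, integral_const_mul,
      integral_const_mul, integral_const_mul, ID]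
    have : ∫ y, f x y ∂μ = D x := by rw [hD]
    rw [this]
    simp
    ring
  have fDm : Measurable fun p : α × α => f p.1 p.2 * D p.2 := by
    exact hf.mul (Dm.comp measurable_snd)
  have fTm : Measurable fun p : α × α => f p.1 p.2 * T p.1 p.2 := hf.mul Tm
  have k1 : Integrable (fun x => ∫ y, T x y ∂μ) μ :=
    bdd_int (Tm.stronglyMeasurable.integral_prod_right').measurable _ fun x => intb (Tb x)
  have k2 : Integrable (fun x => ∫ y, f x y * D y ∂μ) μ :=
    bdd_int (fDm.stronglyMeasurable.integral_prod_right').measurable _ fun x => intb fun y =>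
      mulb (hb x y) (Db y)
  have k3 : Integrable (fun x => ∫ y, f x y * T x y ∂μ) μ :=
    bdd_int (fTm.stronglyMeasurable.integral_prod_right').measurable _ fun x => intb fun y =>
      mulb (hb x y) (Tb x y)
  have k4 : Integrable (fun x => D x ^ 2) μ :=
    bdd_int (Dm.pow_const 2) (1/2*(1/2)) fun x => by rw [sq]; exact mulb (Db x) (Db x)
  have D2 : 0 ≤ ∫ x, D x ^ 2 ∂μ := integral_nonneg fun x => sq_nonneg _
  have l2 : ∫ x, ∫ y, f x y * D y ∂μ ∂μ = ∫ x, D x ^ 2 ∂μ := by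
    rw [integral_integral_swap (f := fun x y => f x y * D y)
      (bdd_int fDm _ fun p => mulb (hb p.1 p.2) (Db p.2))]
    congr 1; funext y
    rw [integral_mul_const]
    have : ∫ x, f x y ∂μ = D y := by
      rw [hD]; congr 1; funext x; exact hs x y
    rw [this, sq]
  have l1 : ∫ x, ∫ y, T x y ∂μ ∂μ = ∫ x, D x ^ 2 ∂μ := by
    rw [← l2]
    congr 1; funext x
    rw [hT]
    have hm : Measurable fun p : α × α => f p.1 p.2 * f p.2 x :=
      hf.mul ((hm2 x).comp measurable_snd)
    show ∫ y, ∫ z, f y z * f z x ∂μ ∂μ = _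
    rw [integral_integral_swap (f := fun y z => f y z * f z x) (bdd_int hm _ fun p => mulb (hb p.1 p.2) (hb p.2 x))]
    congr 1; funext z
    rw [integral_mul_const]
    have : ∫ y, f y z ∂μ = D z := by
      rw [hD]; congr 1; funext x; exact hs x z
    rw [this, hs z x, mul_comm]
  have s3 : ∫ x, ∫ y, ∫ z, (1/2 + f x y) * (1/2 + f y z) * (1/2 + f z x) ∂μ ∂μ ∂μ
      = 1/8 + 3/2 * ∫ x, D x ^ 2 ∂μ + ∫ x, ∫ y, f x y * T x y ∂μ ∂μ := by
    simp_rw [s1, s2]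
    have j1 : Integrable (fun x => 1/8 + 1/2 * D x) μ :=
      (integrable_const _).fun_add (Di.const_mul _)
    have j2 := j1.fun_add (k4.const_mul (1/2))
    have j3 := j2.fun_add (k1.const_mul (1/2))
    have j4 := j3.fun_add (k2.const_mul (1/2))
    rw [integral_add j4 k3, integral_add j3 (k2.const_mul _), integral_add j2 (k1.const_mul _),
      integral_add j1 (k4.const_mul _), integral_add (integrable_const _) (Di.const_mul _),
      integral_const_mul, integral_const_mul, integral_const_mul, integral_const_mul, ID, l1, l2]
    simp
    ring
  have T2 : ∀ x y, T x y ^ 2 ≤ A x * A y := by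
    intro x y
    have := cs_int (μ := μ) (hm1 y) (hm2 x) (1/2) (hb y) (fun z => hb z x)
    rw [hT, hA]
    simp_rw [fun z => hs z x] at this
    calc (∫ z, f y z * f z x ∂μ)^2 = (∫ z, f y z * f x z ∂μ)^2 := by simp_rw [fun z => hs z x]
      _ ≤ _ := this
      _ = _ := mul_comm _ _
  have f2i : Integrable (fun p : α × α => f p.1 p.2 ^ 2) (μ.prod μ) :=
    bdd_int (hf.pow_const 2) _ fun p => sqb p.1 p.2
  have T2i : Integrable (fun p : α × α => T p.1 p.2 ^ 2) (μ.prod μ) :=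
    bdd_int (Tm.pow_const 2) (1/2*(1/2)*(1/2*(1/2))) fun p => by
      rw [sq]; exact mulb (Tb p.1 p.2) (Tb p.1 p.2)
  have AAi : Integrable (fun p : α × α => A p.1 * A p.2) (μ.prod μ) :=
    bdd_int ((Am.comp measurable_fst).mul (Am.comp measurable_snd)) _
      fun p => mulb (Ab p.1) (Ab p.2)
  have c1 := cs_int (μ := μ.prod μ) (F := fun p => f p.1 p.2) (G := fun p => T p.1 p.2) hf Tm (1/2)
    (fun p => hb _ _) (fun p => (Tb _ _).trans (by norm_num))
  have c2 : ∫ p, T p.1 p.2 ^ 2 ∂(μ.prod μ) ≤ ∫ p : α × α, A p.1 * A p.2 ∂(μ.prod μ) :=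
    integral_mono T2i AAi fun p => T2 _ _
  rw [integral_prod_mul] at c2
  have fTi' : Integrable (fun p : α × α => f p.1 p.2 * T p.1 p.2) (μ.prod μ) :=
    bdd_int fTm _ fun p => mulb (hb p.1 p.2) (Tb p.1 p.2)
  rw [integral_prod _ fTi', integral_prod _ f2i] at c1
  have SA : ∫ x, A x ∂μ = ∫ x, ∫ y, f x y ^ 2 ∂μ ∂μ := by rw [hA]
  rw [SA] at c2
  have S0 : 0 ≤ ∫ x, ∫ y, f x y ^ 2 ∂μ ∂μ :=
    integral_nonneg fun x => integral_nonneg fun y => sq_nonneg _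
  rw [s3] at ht8 ⊢
  have c3 := mul_le_mul_of_nonneg_left c2 S0
  simp only at c1
  set X := ∫ x, ∫ y, f x y * T x y ∂μ ∂μ
  nlinarith

lemma I0_eq (u : ℝ) : I0 u = -(1/2) * Real.binEntropy u := by
  unfold I0; rw [Real.binEntropy_eq_negMulLog_add_negMulLog_one_sub]; unfold Real.negMulLog; ring

lemma L_mono {x y : ℝ} (hx : 0 < x) (hxy : x ≤ y) (hy : y < 1) :
    (Real.log (1 + x) - Real.log (1 - x)) * y ≤ (Real.log (1 + y) - Real.log (1 - y)) * x := by
  have h1 := (Real.hasSum_log_sub_log_of_abs_lt_one (x := x) (by rw [abs_of_pos hx]; linarith)).mul_right y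
  have h2 := (Real.hasSum_log_sub_log_of_abs_lt_one (x := y) (by rw [abs_of_pos (by linarith)]; linarith)).mul_right x
  refine hasSum_le (fun k => ?_) h1 h2
  have : x ^ (2*k) ≤ y ^ (2*k) := pow_le_pow_left₀ hx.le hxy _
  have hy0 : 0 < y := by linarith
  calc _ = (2 * (1 / (2 * (k:ℝ) + 1)) * x * y) * x^(2*k) := by ring
    _ ≤ (2 * (1 / (2 * (k:ℝ) + 1)) * x * y) * y^(2*k) := by gcongr
    _ = _ := by ring

lemma J_convex : ConvexOn ℝ (Icc (0:ℝ) 1) fun s => I0 ((1 + √s) / 2) := by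
  have hd : ∀ s ∈ Ioo (0:ℝ) 1, HasDerivAt (fun s => I0 ((1 + √s) / 2))
      ((Real.log (1 + √s) - Real.log (1 - √s)) / √s / 8) s := by
    intro s hs
    have h0 : 0 < √s := Real.sqrt_pos.2 hs.1
    have h1 : √s < 1 := by rw [Real.sqrt_lt' one_pos]; simpa using hs.2
    have hi : HasDerivAt (fun s => (1 + √s) / 2) (1 / (2 * √s) / 2) s :=
      ((Real.hasDerivAt_sqrt hs.1.ne').const_add 1).div_const 2
    have hb := Real.hasDerivAt_binEntropy (p := (1 + √s) / 2) (by linarith) (by linarith)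
    have := (hb.comp s hi).const_mul (-(1/2))
    have e : (fun s => I0 ((1 + √s) / 2)) = fun s => -(1/2) * (Real.binEntropy ∘ fun s => (1 + √s) / 2) s := by
      funext s; exact I0_eq _
    rw [e]
    refine this.congr_deriv ?_
    have e1 : 1 - (1 + √s)/2 = (1 - √s)/2 := by ring
    rw [e1, Real.log_div (by linarith) (by norm_num), Real.log_div (by linarith) (by norm_num)]
    field_simp
    ring
  refine MonotoneOn.convexOn_of_deriv (convex_Icc 0 1) ?_ ?_ ?_
  · have : Continuous fun s => I0 ((1 + √s) / 2) := by
      simp_rw [I0_eq]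
      have := Real.binEntropy_continuous
      fun_prop
    exact this.continuousOn
  · rw [interior_Icc]
    exact fun s hs => (hd s hs).differentiableAt.differentiableWithinAt
  · rw [interior_Icc]
    intro a ha b hb hab
    rw [(hd a ha).deriv, (hd b hb).deriv]
    have h0 : 0 < √a := Real.sqrt_pos.2 ha.1
    have h0' : 0 < √b := Real.sqrt_pos.2 hb.1
    have h1 : √b < 1 := by rw [Real.sqrt_lt' one_pos]; simpa using hb.2
    have := L_mono h0 (Real.sqrt_le_sqrt hab) h1
    have : (Real.log (1 + √a) - Real.log (1 - √a)) / √a ≤ (Real.log (1 + √b) - Real.log (1 - √b)) / √b := by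
      rw [div_le_div_iff₀ h0 h0']; exact this
    linarith

lemma I0_half (u : ℝ) : I0 (1/2 + u) = I0 ((1 + √(4 * u^2)) / 2) := by
  have : √(4 * u^2) = 2 * |u| := by
    rw [← Real.sqrt_sq_eq_abs, Real.sqrt_mul (by norm_num)]
    congr 1
    rw [show (4:ℝ) = 2^2 by norm_num]; exact Real.sqrt_sq (by norm_num)
  rw [this]
  rcases abs_cases u with ⟨h, _⟩ | ⟨h, _⟩
  · rw [h]; congr 1; ring
  · rw [h, I0_eq, I0_eq, ← Real.binEntropy_one_sub]; congr 2; ring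

lemma core {α : Type*} [MeasurableSpace α] (μ : Measure α) [IsProbabilityMeasure μ]
    (f : α → α → ℝ) (hf : Measurable (Function.uncurry f)) (hb : ∀ x y, |f x y| ≤ 1/2)
    (hs : ∀ x y, f x y = f y x) (h0 : ∫ x, ∫ y, f x y ∂μ ∂μ = 0) (t : ℝ) (ht0 : 0 ≤ t) (ht8 : t ≤ 1/8)
    (ht : ∫ x, ∫ y, ∫ z, (1/2 + f x y) * (1/2 + f y z) * (1/2 + f z x) ∂μ ∂μ ∂μ = t) :
    I0 (1/2 + (1/8 - t) ^ ((1:ℝ)/3)) ≤ ∫ x, ∫ y, I0 (1/2 + f x y) ∂μ ∂μ := by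
  have h1 := tri_bound μ f hf hb hs h0
  rw [ht] at h1
  specialize h1 ht8
  set S := ∫ x, ∫ y, f x y ^ 2 ∂μ ∂μ with hS
  set ε := (1/8 - t) ^ ((1:ℝ)/3) with hε
  have e0 : 0 ≤ ε := Real.rpow_nonneg (by linarith) _
  have e3 : ε ^ 3 = 1/8 - t := by
    rw [hε, ← Real.rpow_natCast, ← Real.rpow_mul (by linarith)]; norm_num
  have S0 : 0 ≤ S :=
    integral_nonneg fun x => integral_nonneg fun y => sq_nonneg _
  have eS : ε ^ 2 ≤ S := by
    rw [← e3] at h1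
    exact le_of_pow_le_pow_left₀ (n := 3) (by norm_num) S0 (by calc _ = _ := by ring
                                                                   _ ≤ _ := h1)
  have sqb : ∀ x y, f x y ^ 2 ≤ 1/4 := fun x y => by
    have := pow_le_pow_left₀ (abs_nonneg _) (hb x y) 2
    rw [sq_abs] at this; linarith
  have m4 : Measurable fun p : α × α => 4 * f p.1 p.2 ^ 2 := (hf.pow_const 2).const_mul 4
  have i4 : Integrable (fun p : α × α => 4 * f p.1 p.2 ^ 2) (μ.prod μ) :=
    bdd_int m4 1 fun p => by
      rw [abs_of_nonneg (by positivity)]; linarith [sqb p.1 p.2]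
  have hc : Continuous fun s => I0 ((1 + √s) / 2) := by
    simp_rw [I0_eq]
    have := Real.binEntropy_continuous
    fun_prop
  have hmem : ∀ p : α × α, 4 * f p.1 p.2 ^ 2 ∈ Icc (0:ℝ) 1 := fun p =>
    ⟨by positivity, by linarith [sqb p.1 p.2]⟩
  obtain ⟨C, hC⟩ := isCompact_Icc.exists_bound_of_continuousOn (s := Icc (0:ℝ) 1) hc.continuousOn
  have iI : Integrable (fun p : α × α => I0 ((1 + √(4 * f p.1 p.2 ^ 2)) / 2)) (μ.prod μ) :=
    bdd_int (hc.measurable.comp m4) C fun p => hC _ (hmem p)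
  have J := J_convex.map_integral_le (μ := μ.prod μ) (f := fun p : α × α => 4 * f p.1 p.2 ^ 2)
    hc.continuousOn isClosed_Icc (Filter.Eventually.of_forall hmem) i4 iI
  rw [integral_prod _ iI, integral_prod _ i4] at J
  simp_rw [integral_const_mul] at J
  rw [← hS] at J
  simp_rw [I0_half (f _ _)]
  refine le_trans ?_ J
  rw [I0_half]
  have S1 : 4 * S ≤ 1 := by
    have : (4 * S) ∈ Icc (0:ℝ) 1 := by
      have := (convex_Icc (0:ℝ) 1).integral_mem (μ := μ.prod μ) isClosed_Icc (Filter.Eventually.of_forall hmem) i4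
      rw [integral_prod _ i4] at this
      simp_rw [integral_const_mul] at this
      exact this
    exact this.2
  rw [I0_eq, I0_eq]
  have r1 : √(4 * S) ≤ 1 := Real.sqrt_le_one.2 S1
  have r2 : √(4 * ε^2) ≤ √(4 * S) := Real.sqrt_le_sqrt (by linarith)
  have r0 := Real.sqrt_nonneg (4 * ε^2)
  have := Real.binEntropy_strictAntiOn.antitoneOn (a := (1 + √(4 * ε^2))/2) (b := (1 + √(4 * S))/2)
    ⟨by rw [← one_div]; linarith, by linarith⟩ ⟨by rw [← one_div]; linarith, by linarith⟩ (by linarith)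
  linarith

/-- For `0 ≤ t ≤ 1/8` and `ε = (1/8 - t)^{1/3}`, every graphon with edge density
`1/2` and triangle density `t` satisfies `I(g) ≥ I₀(1/2 + ε)`. -/
theorem rate_lower_bound_half (t : ℝ) (ht0 : 0 ≤ t) (ht8 : t ≤ 1/8)
    (g : ℝ → ℝ → ℝ) (hg : IsGraphon g)
    (he : edgeDensity g = 1/2) (htg : triangleDensity g = t) :
    rateFn g ≥ I0 (1/2 + (1/8 - t) ^ ((1:ℝ)/3)) := by
  obtain ⟨hm, hsym, hr⟩ := hg
  classical
  set μ : Measure ℝ := volume.restrict (Icc (0:ℝ) 1) with hμ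
  haveI : IsProbabilityMeasure μ := ⟨by simp [hμ]⟩
  obtain ⟨f, hf⟩ : ∃ f : ℝ → ℝ → ℝ, f = fun x y =>
    (Icc (0:ℝ) 1 ×ˢ Icc (0:ℝ) 1).indicator (fun p : ℝ × ℝ => g p.1 p.2 - 1/2) (x, y) := ⟨_, rfl⟩
  have f_in : ∀ x ∈ Icc (0:ℝ) 1, ∀ y ∈ Icc (0:ℝ) 1, f x y = g x y - 1/2 := fun x hx y hy => by
    rw [hf]; simp only; rw [indicator_of_mem (mk_mem_prod hx hy)]
  have f_out : ∀ x y, ¬ (x ∈ Icc (0:ℝ) 1 ∧ y ∈ Icc (0:ℝ) 1) → f x y = 0 := fun x y h => by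
    rw [hf]; simp only; rw [indicator_of_notMem]; exact h
  have fm : Measurable (Function.uncurry f) := by
    rw [hf]
    exact Measurable.indicator (hm.sub_const (1/2)) (measurableSet_Icc.prod measurableSet_Icc)
  have fb : ∀ x y, |f x y| ≤ 1/2 := fun x y => by
    by_cases h : x ∈ Icc (0:ℝ) 1 ∧ y ∈ Icc (0:ℝ) 1
    · rw [f_in x h.1 y h.2, abs_le]
      have := hr x h.1 y h.2
      constructor <;> linarith [this.1, this.2]
    · rw [f_out x y h]; norm_num
  have fs : ∀ x y, f x y = f y x := fun x y => by
    by_cases h : x ∈ Icc (0:ℝ) 1 ∧ y ∈ Icc (0:ℝ) 1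
    · rw [f_in x h.1 y h.2, f_in y h.2 x h.1, hsym x h.1 y h.2]
    · rw [f_out x y h, f_out y x fun h' => h h'.symm]
  have g_in : ∀ x ∈ Icc (0:ℝ) 1, ∀ y ∈ Icc (0:ℝ) 1, g x y = 1/2 + f x y := fun x hx y hy => by
    rw [f_in x hx y hy]; ring
  have E : edgeDensity g = ∫ x, ∫ y, (1/2 + f x y) ∂μ ∂μ :=
    setIntegral_congr_fun measurableSet_Icc fun x hx =>
      setIntegral_congr_fun measurableSet_Icc fun y hy => g_in x hx y hy
  have R : rateFn g = ∫ x, ∫ y, I0 (1/2 + f x y) ∂μ ∂μ :=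
    setIntegral_congr_fun measurableSet_Icc fun x hx =>
      setIntegral_congr_fun measurableSet_Icc fun y hy => by
        show I0 (g x y) = _; rw [g_in x hx y hy]
  have Tr : triangleDensity g
      = ∫ x, ∫ y, ∫ z, (1/2 + f x y) * (1/2 + f y z) * (1/2 + f z x) ∂μ ∂μ ∂μ :=
    setIntegral_congr_fun measurableSet_Icc fun x hx =>
      setIntegral_congr_fun measurableSet_Icc fun y hy =>
        setIntegral_congr_fun measurableSet_Icc fun z hz => by
          show g x y * g y z * g z x = _; rw [g_in x hx y hy, g_in y hy z hz, g_in z hz x hx]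
  have fi : ∀ x, Integrable (fun y => f x y) μ := fun x =>
    bdd_int (fm.comp (by fun_prop : Measurable fun y => (x, y))) _ (fb x)
  have Fi : Integrable (fun x => ∫ y, f x y ∂μ) μ :=
    (bdd_int fm (1/2) fun p => fb p.1 p.2 : Integrable (Function.uncurry f) (μ.prod μ)).integral_prod_left
  have E0 : ∫ x, ∫ y, f x y ∂μ ∂μ = 0 := by
    have e : ∀ x, ∫ y, (1/2 + f x y) ∂μ = 1/2 + ∫ y, f x y ∂μ := fun x => by
      rw [integral_add (integrable_const _) (fi x)]; simp
    simp_rw [e] at E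
    rw [integral_add (integrable_const _) Fi, he] at E
    simp at E
    linarith
  rw [R]
  exact core μ f fm fb fs E0 t ht0 ht8 (Tr.symm.trans htg)
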